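/- Let A be a commutative ring (not necessarily with identity). Then A is a p-nilary ring if and only if A is a completely nilary ring. -/

import Mathlib

/-!
Common definitions.

All rings are associative but not necessarily commutative and not necessarily unital,
so we work with `NonUnitalRing` and `TwoSidedIdeal`.

Since a non-unital ring has no `a ^ 0`, positive powers/products are indexed with a shift:
the index `n : ℕ` always corresponds to the positive exponent/length `n + 1`.
-/

/-- `posPow a n` is the positive power `a ^ (n + 1)` of `a`. -/
def posPow {A : Type*} [NonUnitalRing A] (a : A) : ℕ → A
  | 0 => a
  | n + 1 => posPow a n * a

/-- An element of a (possibly non-unital) ring is nilpotent if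
some positive power of it is `0`. -/
def IsNilpotentElem {A : Type*} [NonUnitalRing A] (a : A) : Prop :=
  ∃ n : ℕ, posPow a n = 0

/-- `IsProdLen S n x` means that `x` is a product of `n + 1` elements of `S`
(multiplied in order, which suffices by associativity). -/
inductive IsProdLen {A : Type*} [NonUnitalRing A] (S : Set A) : ℕ → A → Prop
  | single {a : A} : a ∈ S → IsProdLen S 0 a
  | mul {a x : A} {n : ℕ} : a ∈ S → IsProdLen S n x → IsProdLen S (n + 1) (a * x)

/-- The containment `J * K ⊆ I` of two-sided ideals, expressed elementwise
(this is equivalent, since `J * K` is the additive closure of the set of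
products and `I` is closed under addition). -/
def ProdLE {A : Type*} [NonUnitalRing A] (J K I : TwoSidedIdeal A) : Prop :=
  ∀ x ∈ J, ∀ y ∈ K, x * y ∈ I

/-- `J * K = 0` for two-sided ideals `J`, `K`, expressed elementwise. -/
def ProdEqZero {A : Type*} [NonUnitalRing A] (J K : TwoSidedIdeal A) : Prop :=
  ∀ x ∈ J, ∀ y ∈ K, x * y = 0

/-- The containment `J ^ (m + 1) ⊆ I`, expressed elementwise. -/
def PowLE {A : Type*} [NonUnitalRing A] (J : TwoSidedIdeal A) (m : ℕ)
    (I : TwoSidedIdeal A) : Prop :=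
  ∀ x : A, IsProdLen (J : Set A) m x → x ∈ I

/-- `J ^ (m + 1) = 0`, expressed elementwise; so `∃ m, PowEqZero J m` says that
`J` is a nilpotent ideal. -/
def PowEqZero {A : Type*} [NonUnitalRing A] (J : TwoSidedIdeal A) (m : ℕ) : Prop :=
  ∀ x : A, IsProdLen (J : Set A) m x → x = 0

/-- `I` is a completely nilary ideal: whenever `a * b ∈ I`, some positive power of `a`
or some positive power of `b` lies in `I`. -/
def IsCompletelyNilaryIdeal {A : Type*} [NonUnitalRing A] (I : TwoSidedIdeal A) : Prop :=
  ∀ a b : A, a * b ∈ I → (∃ n : ℕ, posPow a n ∈ I) ∨ (∃ m : ℕ, posPow b m ∈ I)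

/-- `A` is a completely nilary ring: whenever `a * b = 0`, `a` is nilpotent or
`b` is nilpotent. -/
def IsCompletelyNilaryRing (A : Type*) [NonUnitalRing A] : Prop :=
  ∀ a b : A, a * b = 0 → IsNilpotentElem a ∨ IsNilpotentElem b

/-- `I` is a nilary ideal: whenever `J * K ⊆ I` for two-sided ideals `J`, `K`, some
positive power of `J` or of `K` is contained in `I`. -/
def IsNilaryIdeal {A : Type*} [NonUnitalRing A] (I : TwoSidedIdeal A) : Prop :=
  ∀ J K : TwoSidedIdeal A, ProdLE J K I →
    (∃ m : ℕ, PowLE J m I) ∨ (∃ n : ℕ, PowLE K n I)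

/-- `A` is a nilary ring: whenever `J * K = 0` for two-sided ideals `J`, `K`, then `J`
or `K` is nilpotent. -/
def IsNilaryRing (A : Type*) [NonUnitalRing A] : Prop :=
  ∀ J K : TwoSidedIdeal A, ProdEqZero J K →
    (∃ m : ℕ, PowEqZero J m) ∨ (∃ n : ℕ, PowEqZero K n)

/-- `I` is a p-nilary ideal: the nilary condition for principal two-sided ideals. -/
def IsPNilaryIdeal {A : Type*} [NonUnitalRing A] (I : TwoSidedIdeal A) : Prop :=
  ∀ a b : A, ProdLE (TwoSidedIdeal.span {a}) (TwoSidedIdeal.span {b}) I →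
    (∃ m : ℕ, PowLE (TwoSidedIdeal.span {a}) m I) ∨
    (∃ n : ℕ, PowLE (TwoSidedIdeal.span {b}) n I)

/-- `A` is a p-nilary ring: whenever `J * K = 0` for principal two-sided ideals `J`, `K`,
then `J` or `K` is nilpotent. -/
def IsPNilaryRing (A : Type*) [NonUnitalRing A] : Prop :=
  ∀ a b : A, ProdEqZero (TwoSidedIdeal.span {a}) (TwoSidedIdeal.span {b}) →
    (∃ m : ℕ, PowEqZero (TwoSidedIdeal.span {a}) m) ∨
    (∃ n : ℕ, PowEqZero (TwoSidedIdeal.span {b}) n)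

/-- `I` is a weakly nilary ideal: `I` is proper, and whenever `0 ≠ J * K ⊆ I` for two-sided
ideals `J`, `K`, some positive power of `J` or of `K` is contained in `I`. -/
def IsWeaklyNilaryIdeal {A : Type*} [NonUnitalRing A] (I : TwoSidedIdeal A) : Prop :=
  I ≠ ⊤ ∧ ∀ J K : TwoSidedIdeal A, ¬ ProdEqZero J K → ProdLE J K I →
    (∃ m : ℕ, PowLE J m I) ∨ (∃ n : ℕ, PowLE K n I)

theorem mul_eq_zero_of_mem_span_singleton {A : Type*} [NonUnitalCommRing A] {a x y : A}
    (h : a * y = 0) (hx : x ∈ TwoSidedIdeal.span {a}) : x * y = 0 := by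
  induction hx using TwoSidedIdeal.span_induction with
  | mem x hx => rw [Set.mem_singleton_iff.mp hx, h]
  | zero => exact zero_mul y
  | add x z _ _ hx hz => rw [add_mul, hx, hz, add_zero]
  | neg x _ hx => rw [neg_mul, hx, neg_zero]
  | left_absorb r x _ hx => rw [mul_assoc, hx, mul_zero]
  | right_absorb r x _ hx => rw [mul_right_comm, hx, zero_mul]

theorem prodEqZero_span_singleton {A : Type*} [NonUnitalCommRing A] {a b : A}
    (h : a * b = 0) : ProdEqZero (TwoSidedIdeal.span {a}) (TwoSidedIdeal.span {b}) := by
  intro x hx y hy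
  refine mul_eq_zero_of_mem_span_singleton ?_ hx
  rw [mul_comm] at h ⊢
  exact mul_eq_zero_of_mem_span_singleton h hy

/-- If `a ^ (n + 1)` annihilates `z`, then so does the ideal `(a) ^ (n + 1)`. -/
theorem IsProdLen.mul_eq_zero_of_posPow_mul_eq_zero {A : Type*} [NonUnitalCommRing A] {a p : A}
    {n : ℕ} (hp : IsProdLen (TwoSidedIdeal.span {a} : Set A) n p) {z : A}
    (h : posPow a n * z = 0) : p * z = 0 := by
  induction hp generalizing z with
  | single hx => exact mul_eq_zero_of_mem_span_singleton h hx
  | mul hx _ ih =>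
    rw [posPow, mul_assoc] at h
    rw [mul_assoc]
    refine mul_eq_zero_of_mem_span_singleton ?_ hx
    rw [mul_left_comm]
    exact ih h

theorem IsNilpotentElem.exists_powEqZero_span {A : Type*} [NonUnitalCommRing A] {a : A}
    (h : IsNilpotentElem a) : ∃ m : ℕ, PowEqZero (TwoSidedIdeal.span {a}) m := by
  obtain ⟨n, hn⟩ := h
  refine ⟨n + 1, fun p hp ↦ ?_⟩
  cases hp with
  | @mul x q _ _ hq =>
    rw [mul_comm]
    exact hq.mul_eq_zero_of_posPow_mul_eq_zero (by rw [hn, zero_mul])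

theorem isProdLen_posPow {A : Type*} [NonUnitalCommRing A] {S : Set A} {a : A} (ha : a ∈ S)
    (n : ℕ) : IsProdLen S n (posPow a n) := by
  induction n with
  | zero => exact .single ha
  | succ n ih =>
    rw [posPow, mul_comm]
    exact .mul ha ih

theorem PowEqZero.isNilpotentElem {A : Type*} [NonUnitalCommRing A] {J : TwoSidedIdeal A}
    {m : ℕ} (h : PowEqZero J m) {a : A} (ha : a ∈ J) : IsNilpotentElem a :=
  ⟨m, h _ (isProdLen_posPow ha m)⟩

/-- A commutative (possibly non-unital) ring is p-nilary iff it is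
completely nilary. -/
theorem pNilary_iff_completelyNilary_of_comm {A : Type*} [NonUnitalCommRing A] :
    IsPNilaryRing A ↔ IsCompletelyNilaryRing A := by
  have mem_span (a : A) : a ∈ TwoSidedIdeal.span {a} :=
    TwoSidedIdeal.subset_span (Set.mem_singleton a)
  constructor
  · intro h a b hab
    exact (h a b (prodEqZero_span_singleton hab)).imp
      (fun ⟨_, hm⟩ ↦ hm.isNilpotentElem (mem_span a))
      (fun ⟨_, hn⟩ ↦ hn.isNilpotentElem (mem_span b))
  · intro h a b hab
    exact (h a b (hab a (mem_span a) b (mem_span b))).imp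
      IsNilpotentElem.exists_powEqZero_span IsNilpotentElem.exists_powEqZero_span
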